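/- arXiv:1705.08657 — 3 statements merged into one kernel-verified Lean document; each statement's English description precedes it below -/
import Mathlib

section
/- Let A be an integer matrix in ℤ^{m×n}. Then every nonzero integer vector x ∈ ℤ^n with Ax = 0 can be written as a sign-compatible sum x = Σ_{i=1}^{N} g^i of elements g^i of the Graver basis 𝒢(A), with some elements possibly appearing with repetitions; moreover each summand satisfies g^i ⊑ x. -/
/-- Two integer vectors are sign-compatible if they lie in the same orthant. -/
def SignCompat {ι : Type*} (x y : ι → ℤ) : Prop := ∀ i, 0 ≤ x i * y i

/-- The conformal order: `y ⊑ x` iff `y` and `x` are sign-compatible and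
`|y i| ≤ |x i|` for every coordinate. -/
def Conforms {ι : Type*} (y x : ι → ℤ) : Prop :=
  SignCompat y x ∧ ∀ i, |y i| ≤ |x i|

/-- The Graver basis of an integer matrix `A`: the set of `⊑`-minimal nonzero
elements of `ker_ℤ(A)`. -/
def GraverBasis {κ ι : Type*} [Fintype ι] (A : Matrix κ ι ℤ) : Set (ι → ℤ) :=
  {g | g ≠ 0 ∧ A.mulVec g = 0 ∧
    ∀ h : ι → ℤ, h ≠ 0 → A.mulVec h = 0 → Conforms h g → h = g}

theorem conforms_iff {ι : Type*} {y x : ι → ℤ} :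
    Conforms y x ↔ ∀ i, (0 ≤ y i ∧ y i ≤ x i) ∨ (x i ≤ y i ∧ y i ≤ 0) := by
  simp only [Conforms, SignCompat, ← forall_and]
  refine forall_congr' fun i => ⟨?_, ?_⟩
  · rintro ⟨h, h'⟩
    rcases mul_nonneg_iff.1 h with ⟨hy, hx⟩ | ⟨hy, hx⟩
    · rw [abs_of_nonneg hy, abs_of_nonneg hx] at h'
      exact .inl ⟨hy, h'⟩
    · rw [abs_of_nonpos hy, abs_of_nonpos hx] at h'
      exact .inr ⟨by lia, hy⟩
  · rintro (⟨h, h'⟩ | ⟨h, h'⟩)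
    · exact ⟨mul_nonneg h (h.trans h'), abs_le_abs_of_nonneg h h'⟩
    · exact ⟨mul_nonneg_of_nonpos_of_nonpos h' (h.trans h'), abs_le_abs_of_nonpos h' h⟩

theorem Conforms.refl {ι : Type*} (x : ι → ℤ) : Conforms x x :=
  ⟨fun i => mul_self_nonneg (x i), fun _ => le_rfl⟩

theorem Conforms.trans {ι : Type*} {z y x : ι → ℤ} (hzy : Conforms z y)
    (hyx : Conforms y x) : Conforms z x := by
  rw [conforms_iff] at *
  intro i
  have := hzy i
  have := hyx i
  lia

theorem Conforms.sub {ι : Type*} {y x : ι → ℤ} (h : Conforms y x) :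
    Conforms (x - y) x := by
  rw [conforms_iff] at *
  intro i
  have := h i
  simp only [Pi.sub_apply]
  lia

theorem Conforms.signCompat {ι : Type*} {y z x : ι → ℤ} (hy : Conforms y x)
    (hz : Conforms z x) : SignCompat y z := by
  rw [conforms_iff] at hy hz
  intro i
  have hyi := hy i
  have hzi := hz i
  rw [mul_nonneg_iff]
  lia

theorem Conforms.sum_natAbs_lt {ι : Type*} [Fintype ι] {y x : ι → ℤ}
    (h : Conforms y x) (hne : y ≠ x) :
    ∑ i, (y i).natAbs < ∑ i, (x i).natAbs := by
  rw [conforms_iff] at h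
  obtain ⟨j, hj⟩ := Function.ne_iff.1 hne
  refine Finset.sum_lt_sum (fun i _ => ?_) ⟨j, Finset.mem_univ j, ?_⟩
  · have := h i
    lia
  · have := h j
    lia

/-- Every element of the integer kernel is the sum of a list of Graver basis elements
conforming to it. -/
theorem exists_list_graverBasis_sum_eq {κ ι : Type*} [Fintype ι] (A : Matrix κ ι ℤ)
    (x : ι → ℤ) (hker : A.mulVec x = 0) :
    ∃ L : List (ι → ℤ), (∀ g ∈ L, g ∈ GraverBasis A ∧ Conforms g x) ∧ L.sum = x := by
  induction hN : ∑ i, (x i).natAbs using Nat.strong_induction_on generalizing x with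
  | _ N ih =>
    subst hN
    by_cases hx : x = 0
    · exact ⟨[], by simp, by simp [hx]⟩
    by_cases hG : x ∈ GraverBasis A
    · exact ⟨[x], by simp [hG, Conforms.refl], by simp⟩
    obtain ⟨h, h0, hA, hc, hne⟩ : ∃ h : ι → ℤ, h ≠ 0 ∧ A.mulVec h = 0 ∧
        Conforms h x ∧ h ≠ x := by
      by_contra! H
      exact hG ⟨hx, hker, H⟩
    have hne' : x - h ≠ x := by simpa using h0
    obtain ⟨L₁, hL₁, hs₁⟩ := ih _ (hc.sum_natAbs_lt hne) h hA rfl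
    obtain ⟨L₂, hL₂, hs₂⟩ := ih _ (hc.sub.sum_natAbs_lt hne') (x - h)
      (by rw [Matrix.mulVec_sub, hker, hA, sub_zero]) rfl
    refine ⟨L₁ ++ L₂, fun g hg => ?_, by simp [hs₁, hs₂]⟩
    rcases List.mem_append.1 hg with hg | hg
    · exact ⟨(hL₁ g hg).1, (hL₁ g hg).2.trans hc⟩
    · exact ⟨(hL₂ g hg).1, (hL₂ g hg).2.trans hc.sub⟩


/-- Every nonzero integer vector `x` with `A x = 0` is a sign-compatible sum of
Graver basis elements (with possible repetitions), each conforming to `x`. -/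
theorem graver_sign_compatible_decomposition {m n : ℕ}
    (A : Matrix (Fin m) (Fin n) ℤ) (x : Fin n → ℤ)
    (hx : x ≠ 0) (hker : A.mulVec x = 0) :
    ∃ (N : ℕ) (g : Fin N → (Fin n → ℤ)),
      (∀ i, g i ∈ GraverBasis A) ∧
      (∀ i, Conforms (g i) x) ∧
      (∀ i j, SignCompat (g i) (g j)) ∧
      x = ∑ i, g i := by
  obtain ⟨L, hL, hsum⟩ := exists_list_graverBasis_sum_eq A x hker
  have hmem : ∀ i, L.get i ∈ GraverBasis A ∧ Conforms (L.get i) x :=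
    fun i => hL _ (L.get_mem i)
  refine ⟨L.length, L.get, fun i => (hmem i).1, fun i => (hmem i).2,
    fun i j => (hmem i).2.signCompat (hmem j).2, ?_⟩
  rw [← List.sum_ofFn, List.ofFn_get, hsum]
end

section
/- Let f : ℤ^n → ℤ be separable convex, let x ∈ ℤ^n, and let g, h ∈ ℤ^n be sign-compatible. Then f(x + g + h) + f(x) ≥ f(x + g) + f(x + h). -/
/-- A function `ℤ → ℤ` is convex iff its successive differences are nondecreasing. -/
def IntConvex (h : ℤ → ℤ) : Prop :=
  ∀ a b : ℤ, a ≤ b → h (a + 1) - h a ≤ h (b + 1) - h b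

/-- A separable convex function: a sum of univariate convex integer functions
of the individual coordinates. -/
def SepConvex {ι : Type*} [Fintype ι] (f : (ι → ℤ) → ℤ) : Prop :=
  ∃ g : ι → ℤ → ℤ, (∀ i, IntConvex (g i)) ∧ ∀ x, f x = ∑ i, g i (x i)

/-- Increments of a convex function over an interval of fixed length are nondecreasing. -/
theorem IntConvex.add_sub_le_add_sub {φ : ℤ → ℤ} (hφ : IntConvex φ) {a b k : ℤ}
    (hab : a ≤ b) (hk : 0 ≤ k) : φ (a + k) - φ a ≤ φ (b + k) - φ b := by
  induction k, hk using Int.leInduction with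
  | base => simp
  | succ k _ ih =>
    have := hφ (a + k) (b + k) (by lia)
    rw [← add_assoc, ← add_assoc]
    lia

/-- A convex function is superadditive along increments of the same sign. -/
theorem IntConvex.superadditivity {φ : ℤ → ℤ} (hφ : IntConvex φ) (a : ℤ) {u v : ℤ}
    (huv : 0 ≤ u * v) : φ (a + u) + φ (a + v) ≤ φ (a + u + v) + φ a := by
  rcases mul_nonneg_iff.mp huv with ⟨hu, hv⟩ | ⟨hu, hv⟩
  · have := hφ.add_sub_le_add_sub (show a ≤ a + u by lia) hv
    lia
  · have := hφ.add_sub_le_add_sub (show a + u + v ≤ a + v by lia) (neg_nonneg.mpr hv)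
    simp only [add_neg_cancel_right] at this
    lia

/-- Superadditivity of separable convex functions along sign-compatible
directions: `f(x + g + h) + f(x) ≥ f(x + g) + f(x + h)`. -/
theorem sepConvex_superadditivity {n : ℕ}
    (f : (Fin n → ℤ) → ℤ) (hf : SepConvex f)
    (x g h : Fin n → ℤ) (hgh : SignCompat g h) :
    f (x + g) + f (x + h) ≤ f (x + g + h) + f x := by
  obtain ⟨φ, hφ, hf⟩ := hf
  simp only [hf, ← Finset.sum_add_distrib]
  exact Finset.sum_le_sum fun i _ => (hφ i).superadditivity (x i) (hgh i)
end

section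
/- Let D ∈ ℤ^{r×t}, let 1ᵀ = (1 ⋯ 1) ∈ ℤ^{1×t}, let E = (D; 1ᵀ), and let Δ = 1 + ‖D‖_∞ where ‖D‖_∞ denotes the maximum absolute value of an entry of D. Then for every n ≥ 1 and every g = (g^1,…,g^n) ∈ 𝒢(E^{(n)}), the number of indices i ∈ [n] with g^i ≠ 0 is at most t²(2rΔ)^r. -/
/-- The `n`-fold product `E^{(n)}` of the bimatrix `E = (D; A)`. -/
def nFold {r s t : ℕ} (n : ℕ) (D : Matrix (Fin r) (Fin t) ℤ)
    (A : Matrix (Fin s) (Fin t) ℤ) :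
    Matrix (Fin r ⊕ (Fin n × Fin s)) (Fin n × Fin t) ℤ :=
  Matrix.of fun I q =>
    match I with
    | Sum.inl a => D a q.2
    | Sum.inr ia => if q.1 = ia.1 then A ia.2 q.2 else 0

/-- The `1 × t` all-ones row matrix `1ᵀ`. -/
def onesRow (t : ℕ) : Matrix (Fin 1) (Fin t) ℤ := Matrix.of fun _ _ => 1

/-- The maximum absolute value `‖D‖_∞` of an entry of `D`, as a natural number. -/
def matInfNorm {r t : ℕ} (D : Matrix (Fin r) (Fin t) ℤ) : ℕ :=
  Finset.univ.sup fun q : Fin r × Fin t => (D q.1 q.2).natAbs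

theorem factorial_succ_le_two_mul_pow (r : ℕ) : (r + 1).factorial ≤ 2 * r ^ r := by
  rcases Nat.eq_zero_or_pos r with rfl | hr
  · simp
  induction r, hr using Nat.le_induction with
  | base => decide
  | succ r hr ih =>
    have bern : r ^ (r + 1) + (r + 1) * r ^ r ≤ (r + 1) ^ (r + 1) := by
      simpa using pow_add_mul_le_add_pow (a := r) (b := 1) (by omega) (by omega) (r + 1)
    rw [Nat.factorial_succ]
    have h3 : r ^ r ≤ r ^ (r + 1) := Nat.pow_le_pow_right hr (by omega)
    calc (r + 1 + 1) * (r + 1).factorial ≤ (r + 1 + 1) * (2 * r ^ r) := by gcongr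
      _ ≤ 2 * (r + 1) ^ (r + 1) := by nlinarith

/-- An integer matrix with a nontrivial rational kernel has a short nonzero integer kernel vector,
whose coordinates are minors. -/
theorem exists_short_int_kernel_vec {r : ℕ} {S : Type*} [Fintype S]
    (A : Matrix (Fin r) S ℤ) {M : ℤ} (hM : 1 ≤ M) (hA : ∀ i j, |A i j| ≤ M)
    {x : S → ℚ} (hx : x ≠ 0) (hAx : ∀ i, ∑ j, (A i j : ℚ) * x j = 0) :
    ∃ z : S → ℤ, z ≠ 0 ∧ A.mulVec z = 0 ∧ ∑ j, |z j| ≤ (r + 1).factorial * M ^ r := by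
  classical
  let Q : ℕ → Prop := fun k =>
    ∃ (f : Fin k → Fin r) (c : Fin k → S), (A.submatrix f c).det ≠ 0
  have Q0 : Q 0 := ⟨Fin.elim0, Fin.elim0, by simp⟩
  have Q_le {k : ℕ} (hk : Q k) : k ≤ r := by
    obtain ⟨f, c, h⟩ := hk
    have hf : Function.Injective f := fun i j hij => by
      by_contra hne
      exact h (Matrix.det_zero_of_row_eq hne (by ext; simp [hij]))
    simpa using Fintype.card_le_of_injective f hf
  obtain ⟨k, hk, hmax⟩ : ∃ k, Q k ∧ ¬ Q (k + 1) :=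
    ⟨Nat.findGreatest Q r, Nat.findGreatest_spec (Nat.zero_le r) Q0, fun h => by
      have := Nat.le_findGreatest (Q_le h) h
      omega⟩
  have hkr := Q_le hk
  obtain ⟨f, c, hdet⟩ := hk
  have hc : Function.Injective c := fun i j hij => by
    by_contra hne
    exact hdet (Matrix.det_zero_of_column_eq hne (by simp [hij]))
  obtain ⟨j, hj⟩ : ∃ j, j ∉ Set.range c := by
    by_contra! hsurj
    let e : Fin k ≃ S := Equiv.ofBijective c ⟨hc, hsurj⟩
    have h0 : ((A.submatrix f c).map (Int.cast : ℤ → ℚ)).mulVec (x ∘ c) = 0 := by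
      ext i
      rw [Pi.zero_apply, ← hAx (f i), ← e.sum_comp]
      rfl
    have h1 : ((A.submatrix f c).map (Int.cast : ℤ → ℚ)).det ≠ 0 := by
      have := (Int.castRingHom ℚ).map_det (A.submatrix f c)
      simp only [RingHom.mapMatrix_apply] at this
      change ((A.submatrix f c).map (Int.castRingHom ℚ)).det ≠ 0
      rw [← this]
      simpa using hdet
    have h2 := Matrix.eq_zero_of_mulVec_eq_zero h1 h0
    apply hx
    ext s
    obtain ⟨i, rfl⟩ := hsurj s
    exact congrFun h2 i
  let c' : Fin (k + 1) → S := Fin.cons j c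
  have hc' : Function.Injective c' := Fin.cons_injective_iff.2 ⟨hj, hc⟩
  let w : Fin (k + 1) → ℤ := fun l =>
    (-1) ^ (l : ℕ) * (A.submatrix f (c' ∘ l.succAbove)).det
  have hw0 : w 0 = (A.submatrix f c).det := by
    simp only [w, c']
    simp only [Fin.val_zero, pow_zero, one_mul]
    rfl
  have hwker (i : Fin r) : ∑ l, A i (c' l) * w l = 0 := by
    by_contra hne
    refine hmax ⟨Fin.cons i f, c', ?_⟩
    rw [Matrix.det_succ_row_zero]
    convert hne using 1
    refine Finset.sum_congr rfl fun l _ => ?_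
    simp only [w, Matrix.submatrix_submatrix, Matrix.submatrix_apply, Fin.cons_zero]
    have : (Fin.cons i f : Fin (k + 1) → Fin r) ∘ Fin.succ = f := by ext; simp
    rw [this]
    ring
  have hwle (l : Fin (k + 1)) : |w l| ≤ k.factorial * M ^ k := by
    have := Matrix.det_le (A := A.submatrix f (c' ∘ l.succAbove)) (abv := AbsoluteValue.abs)
      (x := M) (fun _ _ => hA _ _)
    simp only [w, abs_mul, abs_pow, abs_neg, abs_one, one_pow, one_mul]
    simpa [nsmul_eq_mul] using this
  let z : S → ℤ := fun s => ∑ l, if c' l = s then w l else 0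
  have hzc (l) : z (c' l) = w l := by simp [z, hc'.eq_iff]
  refine ⟨z, fun h => hdet ?_, ?_, ?_⟩
  · rw [← hw0, ← hzc, h]; rfl
  · ext i
    rw [Pi.zero_apply, ← hwker i]
    simp only [Matrix.mulVec, dotProduct, z, Finset.mul_sum]
    rw [Finset.sum_comm]
    simp
  · calc ∑ s, |z s| ≤ ∑ s, ∑ l, |if c' l = s then w l else 0| :=
          Finset.sum_le_sum fun s _ => Finset.abs_sum_le_sum_abs _ _
      _ = ∑ l, |w l| := by
          rw [Finset.sum_comm]
          simp [apply_ite abs]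
      _ ≤ ∑ l : Fin (k + 1), (k.factorial * M ^ k : ℤ) := Finset.sum_le_sum fun l _ => hwle l
      _ = (k + 1).factorial * M ^ k := by
          simp [Nat.factorial_succ]; ring
      _ ≤ (r + 1).factorial * M ^ r := by
          have : (k + 1).factorial ≤ (r + 1).factorial := Nat.factorial_le (by omega)
          have h2 : M ^ k ≤ M ^ r := pow_le_pow_right₀ hM hkr
          have h3 : (0 : ℤ) ≤ M ^ k := by positivity
          gcongr

/-- A nonzero nonnegative rational kernel vector of an integer matrix supports a short nonzero
nonnegative integer kernel vector. -/
theorem exists_short_nonneg_int_kernel_vec {r : ℕ} {S : Type*} [Fintype S]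
    (A : Matrix (Fin r) S ℤ) {M : ℤ} (hM : 1 ≤ M) (hA : ∀ i j, |A i j| ≤ M)
    {x : S → ℚ} (hx : x ≠ 0) (hx0 : ∀ j, 0 ≤ x j) (hAx : ∀ i, ∑ j, (A i j : ℚ) * x j = 0) :
    ∃ z : S → ℤ, z ≠ 0 ∧ (∀ j, 0 ≤ z j) ∧ (∀ j, x j = 0 → z j = 0) ∧ A.mulVec z = 0 ∧
      ∑ j, z j ≤ (r + 1).factorial * M ^ r := by
  classical
  induction hN : (Finset.univ.filter fun j => x j ≠ 0).card using Nat.strong_induction_on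
    generalizing x with
  | _ N ih =>
  obtain ⟨z, hz, hzx, hAz, hzB⟩ : ∃ z : S → ℤ, z ≠ 0 ∧ (∀ j, x j = 0 → z j = 0) ∧
      A.mulVec z = 0 ∧ ∑ j, |z j| ≤ (r + 1).factorial * M ^ r := by
    let T := {j // x j ≠ 0}
    have sum_T {R : Type} [AddCommMonoid R] (F : S → R) (hF : ∀ j, x j = 0 → F j = 0) :
        ∑ j : T, F j = ∑ j, F j := by
      rw [← Finset.sum_subtype (Finset.univ.filter fun j => x j ≠ 0) (by simp) F]
      exact Finset.sum_subset (Finset.subset_univ _) fun j _ hj => hF j (by simpa using hj)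
    obtain ⟨w, hw, hAw, hwB⟩ := exists_short_int_kernel_vec (A.submatrix id (Subtype.val : T → S))
      hM (fun i j => hA i j) (x := fun j => x j) (fun h => hx (by
        ext j
        by_contra hj
        exact hj (congrFun h ⟨j, hj⟩)))
      (fun i => (sum_T (fun j => (A i j : ℚ) * x j) (by simp +contextual)).trans (hAx i))
    let z : S → ℤ := fun j => if hj : x j ≠ 0 then w ⟨j, hj⟩ else 0
    have hzT (j : T) : z j = w j := by simp [z, j.2]
    have hz0 (j) (hj : x j = 0) : z j = 0 := by simp [z, hj]
    refine ⟨z, fun h => hw ?_, hz0, ?_, ?_⟩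
    · ext j
      rw [← hzT, h]; rfl
    · ext i
      have := congrFun hAw i
      simp only [Matrix.mulVec, dotProduct] at this ⊢
      rw [← this, ← sum_T _ (by simp +contextual [hz0])]
      exact Finset.sum_congr rfl fun j _ => by rw [hzT]; rfl
    · rw [← sum_T _ (by simp +contextual [hz0])]
      simpa [hzT] using hwB
  by_cases hpos : ∀ j, 0 ≤ z j
  · exact ⟨z, hz, hpos, hzx, hAz, by simpa [abs_of_nonneg, hpos] using hzB⟩
  by_cases hneg : ∀ j, z j ≤ 0
  · refine ⟨-z, neg_ne_zero.2 hz, fun j => by simpa using hneg j, fun j hj => by simp [hzx j hj],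
      by rw [Matrix.mulVec_neg, hAz, neg_zero], ?_⟩
    simpa [abs_of_nonpos, hneg] using hzB
  push Not at hpos hneg
  obtain ⟨n, hn⟩ := hpos
  obtain ⟨p₀, hp₀⟩ := hneg
  obtain ⟨p, hp, hmin⟩ := Finset.exists_min_image (Finset.univ.filter fun j => 0 < z j)
    (fun j => x j / z j) ⟨p₀, by simpa using hp₀⟩
  simp only [Finset.mem_filter, Finset.mem_univ, true_and] at hp hmin
  have hpQ : (0 : ℚ) < z p := by exact_mod_cast hp
  set μ : ℚ := x p / z p with hμ
  have hμ0 : 0 ≤ μ := div_nonneg (hx0 p) hpQ.le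
  have hxn : 0 < x n := (hx0 n).lt_of_ne fun h => by have := hzx n h.symm; omega
  let y : S → ℚ := fun j => x j - μ * z j
  have hyp : y p = 0 := by simp [y, hμ, hpQ.ne']
  have hxp : x p ≠ 0 := fun h => by have := hzx p h; omega
  have hyx (j) (hj : x j = 0) : y j = 0 := by simp [y, hj, hzx j hj]
  obtain ⟨v, hv, hv0, hvy, hAv, hvB⟩ := ih _ (by
      rw [← hN]
      refine Finset.card_lt_card (Finset.ssubset_iff_of_subset ?_ |>.2 ⟨p, by simp [hxp], by
        simp [hyp]⟩)
      intro j
      simp only [Finset.mem_filter, Finset.mem_univ, true_and]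
      exact mt (hyx j))
    (x := y) (fun h => by
      have h1 : x n - μ * z n = 0 := congrFun h n
      have h2 : (z n : ℚ) ≤ 0 := by exact_mod_cast hn.le
      nlinarith)
    (fun j => by
      rcases lt_or_ge 0 (z j) with hj | hj
      · have hjQ : (0 : ℚ) < z j := by exact_mod_cast hj
        have := (le_div_iff₀ hjQ).1 (hmin j hj)
        simpa [y] using this
      · have hjQ : (z j : ℚ) ≤ 0 := by exact_mod_cast hj
        have := hx0 j
        simp only [y]
        nlinarith)
    (fun i => by
      have h1 : ∑ j, (A i j : ℚ) * z j = 0 := by exact_mod_cast congrFun hAz i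
      have h2 : ∑ j, (A i j : ℚ) * y j =
          ∑ j, (A i j : ℚ) * x j - μ * ∑ j, (A i j : ℚ) * z j := by
        rw [Finset.mul_sum, ← Finset.sum_sub_distrib]
        exact Finset.sum_congr rfl fun j _ => by simp only [y]; ring
      rw [h2, hAx, h1]; simp) rfl
  exact ⟨v, hv, hv0, fun j hj => hvy j (hyx j hj), hAv, hvB⟩

/-- A nonnegative rational kernel vector dominating no short nonzero nonnegative integer kernel
vector has small sum. -/
theorem sum_le_of_no_short_int_kernel_vec {r : ℕ} {S : Type*} [Fintype S] [DecidableEq S]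
    (A : Matrix (Fin r) S ℤ) {M : ℤ} (hM : 1 ≤ M) (hA : ∀ i j, |A i j| ≤ M)
    {x : S → ℚ} (hx0 : ∀ j, 0 ≤ x j) (hAx : ∀ i, ∑ j, (A i j : ℚ) * x j = 0)
    (hshort : ∀ z : S → ℤ, z ≠ 0 → (∀ j, 0 ≤ z j) → A.mulVec z = 0 →
      ∑ j, z j ≤ (r + 1).factorial * M ^ r → ¬ ∀ j, (z j : ℚ) ≤ x j) :
    ∑ j, x j ≤ (Finset.univ.filter fun j => x j ≠ 0).card *
      ((r + 1).factorial * M ^ r : ℤ) := by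
  induction hN : (Finset.univ.filter fun j => x j ≠ 0).card using Nat.strong_induction_on
    generalizing x with
  | _ N ih =>
  by_cases hx : x = 0
  · subst hx
    simp only [Pi.zero_apply, Finset.sum_const_zero]
    have : 0 ≤ ((r + 1).factorial * M ^ r : ℤ) := by positivity
    have : (0 : ℚ) ≤ ((r + 1).factorial * M ^ r : ℤ) := by exact_mod_cast this
    positivity
  obtain ⟨z, hz, hz0, hzx, hAz, hzB⟩ := exists_short_nonneg_int_kernel_vec A hM hA hx hx0 hAx
  obtain ⟨p₀, hp₀⟩ := Function.ne_iff.1 hz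
  obtain ⟨p, hp, hmin⟩ := Finset.exists_min_image (Finset.univ.filter fun j => 0 < z j)
    (fun j => x j / z j) ⟨p₀, by simpa using (hz0 p₀).lt_of_ne' hp₀⟩
  simp only [Finset.mem_filter, Finset.mem_univ, true_and] at hp hmin
  have hpQ : (0 : ℚ) < z p := by exact_mod_cast hp
  set μ : ℚ := x p / z p with hμ
  have hμ0 : 0 ≤ μ := div_nonneg (hx0 p) hpQ.le
  have hzQ (j) : (0 : ℚ) ≤ z j := by exact_mod_cast hz0 j
  have hμz (j) : μ * z j ≤ x j := by
    rcases (hz0 j).lt_or_eq with hj | hj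
    · exact (le_div_iff₀ (by exact_mod_cast hj)).1 (hmin j hj)
    · simpa [← hj] using hx0 j
  have hμ1 : μ ≤ 1 := by
    by_contra! h
    refine hshort z hz hz0 hAz hzB fun j => ?_
    nlinarith [hμz j, hzQ j]
  let y : S → ℚ := fun j => x j - μ * z j
  have hyp : y p = 0 := by simp [y, hμ, hpQ.ne']
  have hxp : x p ≠ 0 := fun h => by have := hzx p h; omega
  have hyx (j) (hj : x j = 0) : y j = 0 := by simp [y, hj, hzx j hj]
  have hcard : (Finset.univ.filter fun j => y j ≠ 0).card < N := by
    rw [← hN]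
    refine Finset.card_lt_card (Finset.ssubset_iff_of_subset ?_ |>.2 ⟨p, by simp [hxp], by
      simp [hyp]⟩)
    intro j
    simp only [Finset.mem_filter, Finset.mem_univ, true_and]
    exact mt (hyx j)
  have hy := ih _ hcard (x := y) (fun j => sub_nonneg.2 (hμz j))
    (fun i => by
      have h1 : ∑ j, (A i j : ℚ) * z j = 0 := by exact_mod_cast congrFun hAz i
      have h2 : ∑ j, (A i j : ℚ) * y j =
          ∑ j, (A i j : ℚ) * x j - μ * ∑ j, (A i j : ℚ) * z j := by
        rw [Finset.mul_sum, ← Finset.sum_sub_distrib]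
        exact Finset.sum_congr rfl fun j _ => by simp only [y]; ring
      rw [h2, hAx, h1]; simp)
    (fun w hw hw0 hAw hwB hwy => hshort w hw hw0 hAw hwB fun j =>
      (hwy j).trans (sub_le_self _ (mul_nonneg hμ0 (hzQ j)))) rfl
  have hsum : ∑ j, x j = ∑ j, y j + μ * ∑ j, (z j : ℚ) := by
    rw [Finset.mul_sum, ← Finset.sum_add_distrib]
    exact Finset.sum_congr rfl fun j _ => by simp only [y]; ring
  have hzB' : ∑ j, (z j : ℚ) ≤ ((r + 1).factorial * M ^ r : ℤ) := by exact_mod_cast hzB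
  have hzs : 0 ≤ ∑ j, (z j : ℚ) := Finset.sum_nonneg fun j _ => hzQ j
  have hcard' : ((Finset.univ.filter fun j => y j ≠ 0).card : ℚ) + 1 ≤ N := by exact_mod_cast hcard
  generalize (((r + 1).factorial * M ^ r : ℤ) : ℚ) = B at *
  rw [hsum]
  nlinarith

/-- The vector with a `1` at position `a` and a `-1` at position `b` of brick `i`. -/
def exchange {ι τ : Type*} [DecidableEq ι] [DecidableEq τ] (q : ι × τ × τ) : ι × τ → ℤ :=
  Pi.single (q.1, q.2.1) 1 - Pi.single (q.1, q.2.2) 1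

theorem sum_mul_exchange {ι τ : Type*} [Fintype ι] [Fintype τ] [DecidableEq ι] [DecidableEq τ]
    (q : ι × τ × τ) (d : τ → ℤ) :
    ∑ p : ι × τ, d p.2 * exchange q p = d q.2.1 - d q.2.2 := by
  simp [exchange, mul_sub, Finset.sum_sub_distrib, Pi.single_apply]

theorem sum_brick_exchange {ι τ : Type*} [Fintype τ] [DecidableEq ι] [DecidableEq τ]
    (q : ι × τ × τ) (i : ι) : ∑ j, exchange q (i, j) = 0 := by
  by_cases h : i = q.1 <;>
    simp [exchange, Finset.sum_sub_distrib, Pi.single_apply, Prod.ext_iff, h]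

theorem exchange_nonneg {ι τ : Type*} [DecidableEq ι] [DecidableEq τ] {q : ι × τ × τ}
    {g : ι × τ → ℤ} (hq : g (q.1, q.2.2) < 0) {p : ι × τ} (hp : 0 ≤ g p) : 0 ≤ exchange q p := by
  have : p ≠ (q.1, q.2.2) := by rintro rfl; omega
  simp only [exchange, Pi.sub_apply, Pi.single_apply, if_neg this]
  split_ifs <;> simp

theorem exchange_nonpos {ι τ : Type*} [DecidableEq ι] [DecidableEq τ] {q : ι × τ × τ}
    {g : ι × τ → ℤ} (hq : 0 < g (q.1, q.2.1)) {p : ι × τ} (hp : g p ≤ 0) : exchange q p ≤ 0 := by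
  have : p ≠ (q.1, q.2.1) := by rintro rfl; omega
  simp only [exchange, Pi.sub_apply, Pi.single_apply, if_neg this]
  split_ifs <;> simp

/-- A vector all of whose bricks sum to zero is a sign-compatible sum of exchange vectors. -/
theorem exists_eq_sum_exchange {ι τ : Type*} [Fintype ι] [Fintype τ] [DecidableEq ι]
    [DecidableEq τ] (g : ι × τ → ℤ) (hg : ∀ i, ∑ j, g (i, j) = 0) :
    ∃ (m : ℕ) (f : Fin m → ι × τ × τ),
      (∀ k, 0 < g ((f k).1, (f k).2.1) ∧ g ((f k).1, (f k).2.2) < 0) ∧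
        ∑ k, exchange (f k) = g := by
  induction hN : ∑ p, (g p).natAbs using Nat.strong_induction_on generalizing g with
  | _ N ih =>
  by_cases h0 : g = 0
  · exact ⟨0, Fin.elim0, fun k => k.elim0, by simp [h0]⟩
  obtain ⟨⟨i, c⟩, hc⟩ := Function.ne_iff.1 h0
  obtain ⟨a, -, ha⟩ := Finset.exists_pos_of_sum_zero_of_exists_nonzero (fun j => g (i, j)) (hg i)
    ⟨c, Finset.mem_univ _, hc⟩
  obtain ⟨b, -, hb⟩ := Finset.exists_pos_of_sum_zero_of_exists_nonzero (fun j => -g (i, j))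
    (by simpa using hg i) ⟨c, Finset.mem_univ _, by simpa using hc⟩
  replace hb : g (i, b) < 0 := by simpa using hb
  let g' : ι × τ → ℤ := g - exchange (i, a, b)
  have hab : (i, a) ≠ (i, b) := fun h => by rw [h] at ha; omega
  have hpos {p} (hp : 0 < g' p) : 0 < g p := by
    simp only [g', exchange, Pi.sub_apply, Pi.single_apply] at hp
    split_ifs at hp <;> subst_vars <;> omega
  have hneg {p} (hp : g' p < 0) : g p < 0 := by
    simp only [g', exchange, Pi.sub_apply, Pi.single_apply] at hp
    split_ifs at hp <;> subst_vars <;> omega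
  have hle (p) : (g' p).natAbs ≤ (g p).natAbs := by
    simp only [g', exchange, Pi.sub_apply, Pi.single_apply]
    split_ifs <;> subst_vars <;> omega
  have hlt : (g' (i, a)).natAbs < (g (i, a)).natAbs := by
    simp only [g', exchange, Pi.sub_apply, Pi.single_apply, if_neg hab]
    simp only [if_true]
    omega
  obtain ⟨m, f, hf, hsum⟩ := ih _ (hN ▸ Finset.sum_lt_sum (fun p _ => hle p)
    ⟨(i, a), Finset.mem_univ _, hlt⟩) g' (fun i => by
      simp [g', Finset.sum_sub_distrib, hg, sum_brick_exchange]) rfl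
  refine ⟨m + 1, Fin.cons (i, a, b) f, fun k => ?_, ?_⟩
  · cases k using Fin.cases with
    | zero => exact ⟨ha, hb⟩
    | succ k => exact ⟨hpos (hf k).1, hneg (hf k).2⟩
  · rw [Fin.sum_univ_succ]
    simp [hsum, g']

theorem nFold_onesRow_mulVec_eq_zero_iff {r t n : ℕ} (D : Matrix (Fin r) (Fin t) ℤ)
    (g : Fin n × Fin t → ℤ) :
    (nFold n D (onesRow t)).mulVec g = 0 ↔
      (∀ a, ∑ p : Fin n × Fin t, D a p.2 * g p = 0) ∧ ∀ i, ∑ j, g (i, j) = 0 := by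
  have hbrick (i : Fin n) (s : Fin 1) :
      (nFold n D (onesRow t)).mulVec g (Sum.inr (i, s)) = ∑ j, g (i, j) := by
    simp only [Matrix.mulVec, dotProduct, nFold, onesRow, Matrix.of_apply, Fintype.sum_prod_type]
    rw [Finset.sum_eq_single i (fun k _ hk => by simp [hk]) (by simp)]
    simp
  constructor
  · intro h
    exact ⟨fun a => congrFun h (Sum.inl a), fun i => (hbrick i 0).symm.trans (congrFun h _)⟩
  · rintro ⟨hD, hs⟩
    ext (a | ⟨i, s⟩)
    · exact hD a
    · exact (hbrick i s).trans (hs i)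

/-- The matrix whose column at `(a, b)` is the difference of columns `a` and `b` of `D`. -/
def columnDiff {r t : ℕ} (D : Matrix (Fin r) (Fin t) ℤ) : Matrix (Fin r) (Fin t × Fin t) ℤ :=
  Matrix.of fun i p => D i p.1 - D i p.2

/-- The number of exchange vectors of type `p` in a decomposition. -/
def exchangeCount {m : ℕ} {ι τ : Type*} [DecidableEq τ] (f : Fin m → ι × τ × τ) (p : τ × τ) : ℕ :=
  (Finset.univ.filter fun k => (f k).2 = p).card

theorem sum_exchangeCount {m : ℕ} {ι τ : Type*} [Fintype τ] [DecidableEq τ]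
    (f : Fin m → ι × τ × τ) : ∑ p, exchangeCount f p = m := by
  simpa [exchangeCount] using (Finset.card_eq_sum_card_fiberwise (s := Finset.univ)
    (t := Finset.univ) (f := fun k => (f k).2) (fun k _ => by simp)).symm

theorem card_nonzero_bricks_sum_exchange_le {m n t : ℕ} (f : Fin m → Fin n × Fin t × Fin t)
    (T : Finset (Fin m)) :
    (Finset.univ.filter fun i : Fin n => (fun j => (∑ k ∈ T, exchange (f k)) (i, j)) ≠ 0).card ≤
      T.card := by
  refine le_trans (Finset.card_le_card fun i hi => ?_)
    (Finset.card_image_le (s := T) (f := fun k => (f k).1))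
  simp only [Finset.mem_filter, Finset.mem_univ, true_and] at hi
  by_contra hT
  refine hi (funext fun j => ?_)
  simp only [Finset.mem_image, not_exists, not_and] at hT
  rw [Finset.sum_apply]
  refine Finset.sum_eq_zero fun k hk => ?_
  simp [exchange, Prod.ext_iff, Ne.symm (hT k hk)]

/-- If the type counts of a decomposition of a Graver basis element dominate a nonzero kernel
vector of the column difference matrix, the number of nonzero bricks is at most the sum of that
vector. -/
theorem card_nonzero_bricks_le_of_kernel_vec {r t n m : ℕ} {D : Matrix (Fin r) (Fin t) ℤ}
    {g : Fin n × Fin t → ℤ} (hg : g ∈ GraverBasis (nFold n D (onesRow t)))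
    {f : Fin m → Fin n × Fin t × Fin t}
    (hf : ∀ k, 0 < g ((f k).1, (f k).2.1) ∧ g ((f k).1, (f k).2.2) < 0)
    (hsum : ∑ k, exchange (f k) = g) {z : Fin t × Fin t → ℤ} (hz : z ≠ 0) (hz0 : ∀ p, 0 ≤ z p)
    (hzf : ∀ p, z p ≤ exchangeCount f p) (hDz : (columnDiff D).mulVec z = 0) :
    ((Finset.univ.filter fun i : Fin n => (fun j => g (i, j)) ≠ 0).card : ℤ) ≤ ∑ p, z p := by
  have hsub (p) : ∃ T ⊆ Finset.univ.filter (fun k => (f k).2 = p), T.card = (z p).toNat :=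
    Finset.exists_subset_card_eq (by have := hzf p; unfold exchangeCount at this; omega)
  choose U hU hUcard using hsub
  let T : Finset (Fin m) := Finset.univ.filter fun k => k ∈ U (f k).2
  have hfib (p) : (T.filter fun k => (f k).2 = p) = U p := by
    ext k
    simp only [T, Finset.mem_filter, Finset.mem_univ, true_and]
    constructor
    · rintro ⟨h, rfl⟩; exact h
    · intro h
      obtain rfl : (f k).2 = p := by simpa using hU p h
      exact ⟨h, rfl⟩
  have hsumT (F : Fin t × Fin t → ℤ) : ∑ k ∈ T, F (f k).2 = ∑ p, F p * z p := by
    rw [← Finset.sum_fiberwise T (fun k => (f k).2)]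
    refine Finset.sum_congr rfl fun p _ => ?_
    rw [Finset.sum_congr rfl (g := fun _ => F p) (fun k hk => by rw [(Finset.mem_filter.1 hk).2]),
      hfib, Finset.sum_const, hUcard, nsmul_eq_mul, Int.toNat_of_nonneg (hz0 p), mul_comm]
  have hTcard : (T.card : ℤ) = ∑ p, z p := by simpa using hsumT fun _ => 1
  have hle (p) (S : Finset (Fin m)) (hp : 0 ≤ g p) : 0 ≤ (∑ k ∈ S, exchange (f k)) p := by
    rw [Finset.sum_apply]
    exact Finset.sum_nonneg fun k _ => exchange_nonneg (hf k).2 hp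
  have hge (p) (S : Finset (Fin m)) (hp : g p ≤ 0) : (∑ k ∈ S, exchange (f k)) p ≤ 0 := by
    rw [Finset.sum_apply]
    exact Finset.sum_nonpos fun k _ => exchange_nonpos (hf k).1 hp
  have hsplit (p) : (∑ k ∈ T, exchange (f k)) p + (∑ k ∈ Tᶜ, exchange (f k)) p = g p := by
    rw [← Pi.add_apply, Finset.sum_add_sum_compl, hsum]
  have heq : ∑ k ∈ T, exchange (f k) = g := by
    refine hg.2.2 _ ?_ ?_ ⟨fun p => ?_, fun p => ?_⟩
    · obtain ⟨p, hp⟩ := Function.ne_iff.1 hz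
      obtain ⟨k, hk⟩ : (U p).Nonempty := by
        rw [← Finset.card_pos, hUcard]
        have := hz0 p
        simp only [Pi.zero_apply] at hp
        omega
      have hkT : k ∈ T := (Finset.mem_filter.1 (hfib p ▸ hk)).1
      obtain ⟨h1, h2⟩ := hf k
      intro h
      have h3 := congrFun h ((f k).1, (f k).2.1)
      rw [Finset.sum_apply, Pi.zero_apply, Finset.sum_eq_zero_iff_of_nonneg
        fun l _ => exchange_nonneg (hf l).2 h1.le] at h3
      have h4 := h3 k hkT
      have h5 : (f k).2.1 ≠ (f k).2.2 := fun h => by rw [h] at h1; omega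
      simp [exchange, h5] at h4
    · rw [nFold_onesRow_mulVec_eq_zero_iff]
      constructor
      · intro a
        simp only [Finset.sum_apply, Finset.mul_sum]
        rw [Finset.sum_comm]
        simp only [sum_mul_exchange]
        rw [hsumT fun p => D a p.1 - D a p.2]
        exact congrFun hDz a
      · intro i
        simp only [Finset.sum_apply]
        rw [Finset.sum_comm]
        simp [sum_brick_exchange]
    · rcases le_total 0 (g p) with hp | hp
      · exact mul_nonneg (hle p T hp) hp
      · exact mul_nonneg_of_nonpos_of_nonpos (hge p T hp) hp
    · have := hsplit p
      rcases le_total 0 (g p) with hp | hp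
      · have := hle p Tᶜ hp
        rw [abs_of_nonneg hp, abs_of_nonneg (hle p T hp)]
        omega
      · have := hge p Tᶜ hp
        rw [abs_of_nonpos hp, abs_of_nonpos (hge p T hp)]
        omega
  rw [← hTcard, ← heq]
  exact_mod_cast card_nonzero_bricks_sum_exchange_le f T

theorem abs_columnDiff_le {r t : ℕ} (D : Matrix (Fin r) (Fin t) ℤ) (i : Fin r)
    (p : Fin t × Fin t) : |columnDiff D i p| ≤ 2 * (1 + matInfNorm D : ℤ) := by
  have h (j : Fin t) : (D i j).natAbs ≤ matInfNorm D :=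
    Finset.le_sup (f := fun q : Fin r × Fin t => (D q.1 q.2).natAbs) (Finset.mem_univ (i, j))
  have h1 := h p.1
  have h2 := h p.2
  simp only [columnDiff, Matrix.of_apply]
  rw [abs_le]
  omega

theorem two_mul_card_le_of_swap_notMem {t : ℕ} (s : Finset (Fin t × Fin t))
    (hs : ∀ p ∈ s, p.swap ∉ s) : 2 * s.card ≤ t ^ 2 := by
  have hdisj : Disjoint s (s.map (Equiv.prodComm _ _).toEmbedding) := by
    rw [Finset.disjoint_left]
    intro p hp hp'
    obtain ⟨q, hq, rfl⟩ := Finset.mem_map.1 hp'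
    exact hs q hq hp
  have := (s ∪ s.map (Equiv.prodComm _ _).toEmbedding).card_le_univ
  rw [Finset.card_union_of_disjoint hdisj, Finset.card_map] at this
  simp only [Fintype.card_prod, Fintype.card_fin] at this
  nlinarith

/-- Combinatorial `n`-fold IP (`E = (D; 1ᵀ)`): every Graver basis element of
`E^{(n)}` has at most `t²(2rΔ)^r` nonzero bricks, where `Δ = 1 + ‖D‖_∞`. -/
theorem comb_nfold_graver_complexity {r t n : ℕ} (hn : 1 ≤ n)
    (D : Matrix (Fin r) (Fin t) ℤ)
    (g : Fin n × Fin t → ℤ) (hg : g ∈ GraverBasis (nFold n D (onesRow t))) :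
    (Finset.univ.filter fun i : Fin n => (fun j => g (i, j)) ≠ 0).card ≤
      t ^ 2 * (2 * r * (1 + matInfNorm D)) ^ r := by
  obtain ⟨hker, hbrick⟩ := (nFold_onesRow_mulVec_eq_zero_iff D g).1 hg.2.1
  obtain ⟨m, f, hf, hsum⟩ := exists_eq_sum_exchange g hbrick
  have hne {k} : (f k).2.1 ≠ (f k).2.2 := fun h => by
    have h1 := hf k
    rw [h] at h1
    omega
  have hbricks : (Finset.univ.filter fun i : Fin n => (fun j => g (i, j)) ≠ 0).card ≤ m := by
    have h := card_nonzero_bricks_sum_exchange_le f Finset.univ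
    rwa [hsum, Finset.card_univ, Fintype.card_fin] at h
  have hcount {p} (hp : exchangeCount f p ≠ 0) : ∃ k, (f k).2 = p := by
    obtain ⟨k, hk⟩ := Finset.card_ne_zero.1 hp
    exact ⟨k, (Finset.mem_filter.1 hk).2⟩
  by_cases hswap : ∃ p, exchangeCount f p ≠ 0 ∧ exchangeCount f p.swap ≠ 0
  · obtain ⟨p, hp, hp'⟩ := hswap
    obtain ⟨k, rfl⟩ := hcount hp
    have hpp : (f k).2 ≠ (f k).2.swap := fun h => hne (congrArg Prod.fst h)
    have h2 := card_nonzero_bricks_le_of_kernel_vec hg hf hsum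
      (z := Pi.single (f k).2 1 + Pi.single (f k).2.swap 1)
      (fun h => by simpa [hpp] using congrFun h (f k).2)
      (fun q => by
        simp only [Pi.add_apply, Pi.single_apply]
        split_ifs <;> simp)
      (fun q => by
        simp only [Pi.add_apply, Pi.single_apply]
        split_ifs with h1 h2 h2
        · exact absurd (h1.symm.trans h2) hpp
        · subst h1; omega
        · subst h2; omega
        · simp)
      (by
        ext i
        simp [Matrix.mulVec_add, columnDiff])
    have ht : 2 ≤ t := by
      have h1 := (f k).2.1.isLt
      have h2 := (f k).2.2.isLt
      have h3 : ((f k).2.1 : ℕ) ≠ (f k).2.2 := fun h => hne (Fin.ext h)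
      omega
    have hpow : 1 ≤ (2 * r * (1 + matInfNorm D)) ^ r := by
      rcases Nat.eq_zero_or_pos r with rfl | hr
      · simp
      · exact Nat.one_le_pow _ _ (by positivity)
    have : (Finset.univ.filter fun i : Fin n => (fun j => g (i, j)) ≠ 0).card ≤ 2 := by
      simpa [Finset.sum_add_distrib] using h2
    nlinarith
  push Not at hswap
  set M : ℕ := 2 * (1 + matInfNorm D) with hM
  set s := Finset.univ.filter fun p => (exchangeCount f p : ℚ) ≠ 0 with hs
  have hs2 : 2 * s.card ≤ t ^ 2 := two_mul_card_le_of_swap_notMem s fun p hp hp' => by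
    simp only [hs, Finset.mem_filter, Finset.mem_univ, true_and, Nat.cast_ne_zero] at hp hp'
    exact hp' (hswap p hp)
  have hB : s.card * ((r + 1).factorial * M ^ r) ≤
      t ^ 2 * (2 * r * (1 + matInfNorm D)) ^ r := by
    calc s.card * ((r + 1).factorial * M ^ r) ≤ s.card * (2 * r ^ r * M ^ r) := by
          gcongr
          exact factorial_succ_le_two_mul_pow r
      _ = 2 * s.card * (r * M) ^ r := by rw [mul_pow r M r]; ring
      _ ≤ t ^ 2 * (r * M) ^ r := by gcongr
      _ = t ^ 2 * (2 * r * (1 + matInfNorm D)) ^ r := by rw [hM]; ring_nf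
  refine le_trans ?_ hB
  by_cases hshort : ∃ z : Fin t × Fin t → ℤ, z ≠ 0 ∧ (∀ p, 0 ≤ z p) ∧
      (columnDiff D).mulVec z = 0 ∧ ∑ p, z p ≤ (r + 1).factorial * (M : ℤ) ^ r ∧
      ∀ p, z p ≤ exchangeCount f p
  · obtain ⟨z, hz, hz0, hDz, hzB, hzf⟩ := hshort
    have h1 := (card_nonzero_bricks_le_of_kernel_vec hg hf hsum hz hz0 hzf hDz).trans hzB
    have h2 : 1 ≤ s.card := by
      obtain ⟨p, hp⟩ := Function.ne_iff.1 hz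
      refine Finset.card_pos.2 ⟨p, ?_⟩
      have h3 := hz0 p
      have h4 := hzf p
      simp only [Pi.zero_apply] at hp
      simp only [hs, Finset.mem_filter, Finset.mem_univ, true_and, Nat.cast_ne_zero]
      omega
    have h3 : (Finset.univ.filter fun i : Fin n => (fun j => g (i, j)) ≠ 0).card ≤
        (r + 1).factorial * M ^ r := by exact_mod_cast h1
    exact h3.trans (Nat.le_mul_of_pos_left _ h2)
  · refine hbricks.trans ?_
    have h1 := sum_le_of_no_short_int_kernel_vec (columnDiff D) (M := M) (by push_cast [hM]; omega)
      (by simpa [hM] using abs_columnDiff_le D) (x := fun p => (exchangeCount f p : ℚ))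
      (fun p => by positivity)
      (fun a => by
        have h2 : ∑ p, columnDiff D a p * (exchangeCount f p : ℤ) = 0 := by
          rw [← hker a, ← hsum]
          simp only [Finset.sum_apply, Finset.mul_sum]
          rw [Finset.sum_comm]
          simp only [sum_mul_exchange]
          rw [← Finset.sum_fiberwise Finset.univ (fun k => (f k).2)]
          refine Finset.sum_congr rfl fun p _ => ?_
          rw [Finset.sum_congr rfl (g := fun _ => columnDiff D a p) (fun k hk => by
            rw [← (Finset.mem_filter.1 hk).2]; rfl)]
          simp [exchangeCount, mul_comm]
        exact_mod_cast h2)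
      (fun z hz hz0 hDz hzB hzf =>
        hshort ⟨z, hz, hz0, hDz, hzB, fun p => by exact_mod_cast hzf p⟩)
    have h2 : ∑ p, (exchangeCount f p : ℚ) = m := by exact_mod_cast sum_exchangeCount f
    rw [h2] at h1
    rw [hs]
    exact_mod_cast h1
end
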